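/- (Theorem 1, determination form: the joint measure is uniquely determined by the probabilities of all (2Δ+1)-tuples.) Let Ω = Ω_1 × ⋯ × Ω_n be a product of nonempty finite sets. Let P and Q be strictly positive probability measures on Ω, Markov relative to ordering-consistent DAGs G_P and G_Q respectively (possibly different), each of in-degree at most Δ. If for every subset J ⊆ {1,…,n} with |J| ≤ 2Δ+1 the marginal distributions of P and Q on the coordinates in J coincide, then P = Q. -/

import Mathlib

/-- The marginal probability, under a finitely supported distribution `P` on the
product `Ω = Ω_1 × ⋯ × Ω_n`, of the event that all coordinates in `J` take the
values prescribed by `x`. -/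
def marg {n : ℕ} {Ω : Fin n → Type*} [∀ i, Fintype (Ω i)] [∀ i, DecidableEq (Ω i)]
    (P : (∀ i, Ω i) → ℝ) (J : Finset (Fin n)) (x : ∀ i, Ω i) : ℝ :=
  ∑ y : ∀ i, Ω i, if ∀ i ∈ J, y i = x i then P y else 0

/-- `P` is Markov relative to the DAG with parent sets `Pa`: for every point `x`,
`P(x) = ∏_j P(x_j | pa_j)`, written in cross-multiplied form. -/
def IsMarkov {n : ℕ} {Ω : Fin n → Type*} [∀ i, Fintype (Ω i)] [∀ i, DecidableEq (Ω i)]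
    (P : (∀ i, Ω i) → ℝ) (Pa : Fin n → Finset (Fin n)) : Prop :=
  ∀ x : ∀ i, Ω i,
    P x * ∏ j, marg P (Pa j) x = ∏ j, marg P (insert j (Pa j)) x

section Marginals

open Finset

variable {n : ℕ} {Ω : Fin n → Type*} [∀ i, Fintype (Ω i)] [∀ i, DecidableEq (Ω i)]

theorem marg_pos {P : (∀ i, Ω i) → ℝ} (hP : ∀ x, 0 < P x) (J : Finset (Fin n))
    (x : ∀ i, Ω i) : 0 < marg P J x := by
  unfold marg
  refine Finset.sum_pos' (fun y _ => ?_) ⟨x, mem_univ _, by simpa using hP x⟩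
  split_ifs
  · exact (hP y).le
  · exact le_rfl

theorem marg_congr (P : (∀ i, Ω i) → ℝ) {J : Finset (Fin n)} {x y : ∀ i, Ω i}
    (h : ∀ i ∈ J, x i = y i) : marg P J x = marg P J y := by
  unfold marg
  refine Finset.sum_congr rfl fun z _ => ?_
  have : (∀ i ∈ J, z i = x i) ↔ ∀ i ∈ J, z i = y i :=
    forall₂_congr fun i hi => by rw [h i hi]
  simp only [this]

theorem marg_update (P : (∀ i, Ω i) → ℝ) {J : Finset (Fin n)} {k : Fin n} (hk : k ∉ J)
    (x : ∀ i, Ω i) (a : Ω k) : marg P J (Function.update x k a) = marg P J x :=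
  marg_congr P fun _ hi => Function.update_of_ne (ne_of_mem_of_not_mem hi hk) _ _

theorem marg_univ (P : (∀ i, Ω i) → ℝ) (x : ∀ i, Ω i) : marg P univ x = P x := by
  simp [marg, ← funext_iff]

/-- Summing out one coordinate. -/
theorem sum_marg_insert_update (P : (∀ i, Ω i) → ℝ) {J : Finset (Fin n)} {k : Fin n}
    (hk : k ∉ J) (x : ∀ i, Ω i) :
    ∑ a, marg P (insert k J) (Function.update x k a) = marg P J x := by
  unfold marg
  rw [Finset.sum_comm]
  refine Finset.sum_congr rfl fun y _ => ?_
  have key (a : Ω k) : (∀ i ∈ insert k J, y i = Function.update x k a i) ↔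
      y k = a ∧ ∀ i ∈ J, y i = x i := by
    rw [forall_mem_insert, Function.update_self]
    refine and_congr_right fun _ => forall₂_congr fun i hi => ?_
    rw [Function.update_of_ne (ne_of_mem_of_not_mem hi hk)]
  simp only [key, ite_and]
  simp

/-- The conditional probability of the `j`-th coordinate given the coordinates in `J`. -/
noncomputable def condMarg (P : (∀ i, Ω i) → ℝ) (J : Finset (Fin n)) (j : Fin n)
    (x : ∀ i, Ω i) : ℝ :=
  marg P (insert j J) x / marg P J x

theorem condMarg_update (P : (∀ i, Ω i) → ℝ) {J : Finset (Fin n)} {j k : Fin n}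
    (hkj : k ≠ j) (hk : k ∉ J) (x : ∀ i, Ω i) (a : Ω k) :
    condMarg P J j (Function.update x k a) = condMarg P J j x := by
  rw [condMarg, condMarg, marg_update P hk, marg_update P (by simp [hkj, hk])]

theorem sum_condMarg_update {P : (∀ i, Ω i) → ℝ} (hP : ∀ x, 0 < P x)
    {J : Finset (Fin n)} {j : Fin n} (hj : j ∉ J) (x : ∀ i, Ω i) :
    ∑ a, condMarg P J j (Function.update x j a) = 1 := by
  simp only [condMarg, marg_update P hj]
  rw [← Finset.sum_div, sum_marg_insert_update P hj, div_self (marg_pos hP J x).ne']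

theorem IsMarkov.eq_prod_condMarg {P : (∀ i, Ω i) → ℝ} {Pa : Fin n → Finset (Fin n)}
    (h : IsMarkov P Pa) (hP : ∀ x, 0 < P x) (x : ∀ i, Ω i) :
    P x = ∏ j, condMarg P (Pa j) j x := by
  simp only [condMarg]
  rw [Finset.prod_div_distrib,
    eq_div_iff (Finset.prod_ne_zero_iff.2 fun j _ => (marg_pos hP _ x).ne'), h x]

/-- The marginals on initial segments factorize. -/
theorem IsMarkov.marg_initial {P : (∀ i, Ω i) → ℝ} {Pa : Fin n → Finset (Fin n)}
    (h : IsMarkov P Pa) (hP : ∀ x, 0 < P x) (hPa : ∀ j, ∀ i ∈ Pa j, i < j)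
    {k : ℕ} (hk : k ≤ n) (x : ∀ i, Ω i) :
    marg P {i | i.val < k} x = ∏ j with j.val < k, condMarg P (Pa j) j x := by
  induction hk using Nat.decreasingInduction generalizing x with
  | self => simpa [marg_univ] using h.eq_prod_condMarg hP x
  | of_succ k hk ih =>
    have hins : ({i | i.val < k + 1} : Finset (Fin n)) =
        insert (⟨k, hk⟩ : Fin n) ({i : Fin n | i.val < k} : Finset (Fin n)) := by
      ext i; simp [Fin.ext_iff]; omega
    have hnot : (⟨k, hk⟩ : Fin n) ∉ ({i | i.val < k} : Finset (Fin n)) := by simp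
    rw [← sum_marg_insert_update P hnot, ← hins]
    simp only [ih]
    simp only [hins, Finset.prod_insert hnot]
    have hconst (a : Ω ⟨k, hk⟩) :
        ∏ j with j.val < k, condMarg P (Pa j) j (Function.update x ⟨k, hk⟩ a) =
          ∏ j with j.val < k, condMarg P (Pa j) j x := by
      refine Finset.prod_congr rfl fun j hj => ?_
      have hjk : j < ⟨k, hk⟩ := (mem_filter.1 hj).2
      exact condMarg_update P hjk.ne' (fun hmem => (hPa j _ hmem).not_gt hjk) x a
    simp only [hconst]
    rw [← Finset.sum_mul, sum_condMarg_update hP fun hmem => (hPa _ _ hmem).false, one_mul]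

/-- A factorization of the conditional law of the `j`-th coordinate through `J` passes from a
larger set of conditioning coordinates to a smaller one containing `J`. -/
theorem marg_insert_eq_of_union {P : (∀ i, Ω i) → ℝ} {J : Finset (Fin n)} {j : Fin n}
    (T S : Finset (Fin n)) (hJ : J ⊆ S) (hj : j ∉ S ∪ T)
    (h : ∀ x, marg P (insert j (S ∪ T)) x = condMarg P J j x * marg P (S ∪ T) x)
    (x : ∀ i, Ω i) : marg P (insert j S) x = condMarg P J j x * marg P S x := by
  induction T using Finset.induction_on generalizing S x with
  | empty => simpa using h x
  | insert k T _ ih =>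
    have hunion : S ∪ insert k T = insert k S ∪ T := by simp
    rw [hunion] at hj h
    have hins := ih (insert k S) (hJ.trans (subset_insert _ _)) hj h
    by_cases hk : k ∈ S
    · simpa [hk] using hins x
    · have hkj : k ≠ j := by rintro rfl; simp at hj
      rw [← sum_marg_insert_update P (k := k) (by simp [hkj, hk]),
        ← sum_marg_insert_update P hk, Finset.mul_sum]
      refine Finset.sum_congr rfl fun a _ => ?_
      rw [Finset.insert_comm, hins, condMarg_update P hkj fun hmem => hk (hJ hmem)]

/-- Conditioning on any set of predecessors containing the parents is the same as conditioning
on the parents. -/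
theorem IsMarkov.condMarg_eq {P : (∀ i, Ω i) → ℝ} {Pa : Fin n → Finset (Fin n)}
    (h : IsMarkov P Pa) (hP : ∀ x, 0 < P x) (hPa : ∀ j, ∀ i ∈ Pa j, i < j)
    {j : Fin n} {S : Finset (Fin n)} (hS : Pa j ⊆ S) (hSj : ∀ i ∈ S, i < j)
    (x : ∀ i, Ω i) : condMarg P S j x = condMarg P (Pa j) j x := by
  rw [condMarg, div_eq_iff (marg_pos hP S x).ne']
  have hunion : S ∪ ({i : Fin n | i.val < j.val} : Finset (Fin n)) =
      ({i : Fin n | i.val < j.val} : Finset (Fin n)) :=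
    union_eq_right.2 fun i hi => by simpa using hSj i hi
  have hnot : j ∉ ({i | i.val < j.val} : Finset (Fin n)) := by simp
  refine marg_insert_eq_of_union {i | i.val < j.val} S hS (by rwa [hunion]) (fun y => ?_) x
  have hins : insert j ({i : Fin n | i.val < j.val} : Finset (Fin n)) =
      ({i : Fin n | i.val < j.val + 1} : Finset (Fin n)) := by
    ext i; simp [Fin.ext_iff]; omega
  rw [hunion, hins, h.marg_initial hP hPa j.isLt, h.marg_initial hP hPa j.isLt.le, ← hins,
    Finset.prod_insert hnot]

end Marginals

/-- **Theorem 1, determination form.** If `P` and `Q` are strictly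
positive probability measures on `Ω = Ω_1 × ⋯ × Ω_n`, Markov relative to
(possibly different) ordering-consistent DAGs of in-degree at most `Δ`, and their
marginals on all coordinate sets of size at most `2Δ + 1` coincide, then `P = Q`. -/
theorem tuple_marginals_determine_measure_two_graphs
    {n Δ : ℕ} {Ω : Fin n → Type*} [∀ i, Fintype (Ω i)] [∀ i, Nonempty (Ω i)]
    [∀ i, DecidableEq (Ω i)]
    (PaP PaQ : Fin n → Finset (Fin n))
    (horderP : ∀ j : Fin n, ∀ i ∈ PaP j, i < j)
    (horderQ : ∀ j : Fin n, ∀ i ∈ PaQ j, i < j)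
    (hdegP : ∀ j : Fin n, (PaP j).card ≤ Δ)
    (hdegQ : ∀ j : Fin n, (PaQ j).card ≤ Δ)
    (P Q : (∀ i, Ω i) → ℝ)
    (hPpos : ∀ x, 0 < P x) (hQpos : ∀ x, 0 < Q x)
    (hPsum : ∑ x, P x = 1) (hQsum : ∑ x, Q x = 1)
    (hPMarkov : IsMarkov P PaP) (hQMarkov : IsMarkov Q PaQ)
    (hmarg : ∀ J : Finset (Fin n), J.card ≤ 2 * Δ + 1 → ∀ x, marg P J x = marg Q J x) :
    P = Q := by
  funext x
  rw [hPMarkov.eq_prod_condMarg hPpos, hQMarkov.eq_prod_condMarg hQpos]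
  refine Finset.prod_congr rfl fun j _ => ?_
  have hlt : ∀ i ∈ PaP j ∪ PaQ j, i < j := fun i hi =>
    (Finset.mem_union.1 hi).elim (horderP j i) (horderQ j i)
  have hcard : (PaP j ∪ PaQ j).card ≤ 2 * Δ := by
    have := Finset.card_union_le (PaP j) (PaQ j)
    have := hdegP j
    have := hdegQ j
    omega
  rw [← hPMarkov.condMarg_eq hPpos horderP Finset.subset_union_left hlt,
    ← hQMarkov.condMarg_eq hQpos horderQ Finset.subset_union_right hlt, condMarg, condMarg,
    hmarg _ (hcard.trans (Nat.le_succ _)),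
    hmarg _ ((Finset.card_insert_le _ _).trans (Nat.succ_le_succ hcard))]
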